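/- Let π be a permutation of {1,…,n+m}. The family of sets { P⁰_π(i) : 1 ≤ i ≤ n } together with the (underlying sets of the) loops of π forms a partition of {n+1,…,n+m}: these sets are pairwise disjoint (in particular P⁰_π(i) ∩ P⁰_π(j) = ∅ for i ≠ j, distinct loops are disjoint, and no P⁰_π(i) meets any loop), and every element of {n+1,…,n+m} belongs to some P⁰_π(i) or to some loop. -/

import Mathlib

/-- `P⁰_π(i)`: the set of elements of the second block `{n+1,…,n+m}` (values `≥ n` in
`Fin (n+m)`) occurring in the `n`-path of `π` starting at `i` in the first block. -/
def pathSet (n m : ℕ) (π : Equiv.Perm (Fin (n + m))) (i : Fin n) : Set (Fin (n + m)) :=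
  {x | ∃ p : ℕ, 1 ≤ p ∧
    (∀ q : ℕ, 1 ≤ q → q ≤ p → n ≤ (((π ^ q) (Fin.castAdd m i)) : ℕ)) ∧
    (π ^ p) (Fin.castAdd m i) = x}

/-- `j` lies on a loop of `π`: a cycle through `j` lying entirely within the second block. -/
def onLoop (n m : ℕ) (π : Equiv.Perm (Fin (n + m))) (j : Fin (n + m)) : Prop :=
  n ≤ (j : ℕ) ∧ ∃ k : ℕ, 1 ≤ k ∧ (π ^ k) j = j ∧ ∀ p : ℕ, p < k → n ≤ (((π ^ p) j) : ℕ)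

/-- The underlying set of the loop of `π` through `j` (the orbit of `j`). -/
def loopSet (n m : ℕ) (π : Equiv.Perm (Fin (n + m))) (j : Fin (n + m)) : Set (Fin (n + m)) :=
  {x | ∃ p : ℕ, (π ^ p) j = x}

theorem mem_loopSet_iff_sameCycle {n m : ℕ} {π : Equiv.Perm (Fin (n + m))}
    {j x : Fin (n + m)} : x ∈ loopSet n m π j ↔ π.SameCycle j x := by
  constructor
  · rintro ⟨p, hp⟩
    exact ⟨p, by simpa using hp⟩
  · intro h
    obtain ⟨p, -, hp⟩ := h.exists_pow_eq'
    exact ⟨p, hp⟩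

theorem sameCycle_of_mem_pathSet {n m : ℕ} {π : Equiv.Perm (Fin (n + m))} {i : Fin n}
    {x : Fin (n + m)} (h : x ∈ pathSet n m π i) : π.SameCycle (Fin.castAdd m i) x := by
  obtain ⟨p, -, -, hp⟩ := h
  exact ⟨p, by simpa using hp⟩

theorem onLoop.le_of_sameCycle {n m : ℕ} {π : Equiv.Perm (Fin (n + m))}
    {j x : Fin (n + m)} (h : onLoop n m π j) (hx : π.SameCycle j x) : n ≤ (x : ℕ) := by
  obtain ⟨-, k, hk, hfix, hle⟩ := h
  obtain ⟨s, -, rfl⟩ := hx.exists_pow_eq'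
  have hmod : (π ^ s) j = (π ^ (s % k)) j := by
    conv_lhs => rw [← Nat.mod_add_div s k, pow_add, pow_mul, Equiv.Perm.mul_apply,
      Equiv.Perm.pow_apply_eq_self_of_apply_eq_self hfix]
  rw [hmod]
  exact hle _ (Nat.mod_lt _ hk)

theorem eq_of_pow_castAdd_eq_of_le {n m : ℕ} {π : Equiv.Perm (Fin (n + m))} {i j : Fin n}
    {p q : ℕ} (hpq : p ≤ q)
    (hq : ∀ r : ℕ, 1 ≤ r → r ≤ q → n ≤ (((π ^ r) (Fin.castAdd m j)) : ℕ))
    (h : (π ^ p) (Fin.castAdd m i) = (π ^ q) (Fin.castAdd m j)) : i = j := by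
  obtain ⟨d, rfl⟩ := Nat.exists_eq_add_of_le hpq
  rw [pow_add, Equiv.Perm.mul_apply] at h
  have hi := (π ^ p).injective h
  rcases Nat.eq_zero_or_pos d with rfl | hd
  · simpa using hi
  · have hn := hq d hd (by omega)
    rw [← hi, Fin.val_castAdd] at hn
    omega

theorem exists_mem_pathSet_of_sameCycle {n m : ℕ} {π : Equiv.Perm (Fin (n + m))}
    {x y : Fin (n + m)} (hx : n ≤ (x : ℕ)) (hy : (y : ℕ) < n) (h : π.SameCycle y x) :
    ∃ i : Fin n, x ∈ pathSet n m π i := by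
  classical
  have hex : ∃ p : ℕ, ∃ i : Fin n, (π ^ p) (Fin.castAdd m i) = x := by
    obtain ⟨p, -, hp⟩ := h.exists_pow_eq'
    exact ⟨p, ⟨y, hy⟩, hp⟩
  obtain ⟨i, hi⟩ := Nat.find_spec hex
  refine ⟨i, Nat.find hex, ?_, fun q hq hqp => ?_, hi⟩
  · by_contra! h0
    rw [Nat.lt_one_iff.mp h0, pow_zero, Equiv.Perm.one_apply] at hi
    rw [← hi, Fin.val_castAdd] at hx
    omega
  · by_contra! hlt
    refine Nat.find_min hex (m := Nat.find hex - q) (by omega)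
      ⟨⟨(π ^ q) (Fin.castAdd m i), hlt⟩, ?_⟩
    change (π ^ (Nat.find hex - q)) ((π ^ q) (Fin.castAdd m i)) = x
    rw [← Equiv.Perm.mul_apply, ← pow_add, Nat.sub_add_cancel hqp, hi]

/-- The family of sets `{P⁰_π(i) : i in the first block}` together with the underlying
sets of the loops of `π` forms a partition of the second block `{n+1,…,n+m}`:
all these sets are pairwise disjoint, and every element of the second block belongs to
some `P⁰_π(i)` or lies on some loop. -/
theorem paths_loops_partition (n m : ℕ) (π : Equiv.Perm (Fin (n + m))) :
    (∀ i j : Fin n, i ≠ j → pathSet n m π i ∩ pathSet n m π j = ∅) ∧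
    (∀ j₁ j₂ : Fin (n + m), onLoop n m π j₁ → onLoop n m π j₂ →
      loopSet n m π j₁ = loopSet n m π j₂ ∨ loopSet n m π j₁ ∩ loopSet n m π j₂ = ∅) ∧
    (∀ (i : Fin n) (j : Fin (n + m)), onLoop n m π j →
      pathSet n m π i ∩ loopSet n m π j = ∅) ∧
    (∀ x : Fin (n + m), n ≤ (x : ℕ) →
      (∃ i : Fin n, x ∈ pathSet n m π i) ∨ onLoop n m π x) := by
  refine ⟨fun i j hij => ?_, fun j₁ j₂ _ _ => ?_, fun i j hj => ?_, fun x hx => ?_⟩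
  · rw [Set.eq_empty_iff_forall_notMem]
    rintro x ⟨⟨p, -, hp, hpx⟩, q, -, hq, hqx⟩
    have h := hpx.trans hqx.symm
    rcases le_total p q with hpq | hqp
    · exact hij (eq_of_pow_castAdd_eq_of_le hpq hq h)
    · exact hij (eq_of_pow_castAdd_eq_of_le hqp hp h.symm).symm
  · by_cases h : π.SameCycle j₁ j₂
    · left
      ext x
      rw [mem_loopSet_iff_sameCycle, mem_loopSet_iff_sameCycle]
      exact ⟨h.symm.trans, h.trans⟩
    · right
      rw [Set.eq_empty_iff_forall_notMem]
      rintro x ⟨h₁, h₂⟩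
      rw [mem_loopSet_iff_sameCycle] at h₁ h₂
      exact h (h₁.trans h₂.symm)
  · rw [Set.eq_empty_iff_forall_notMem]
    rintro x ⟨h₁, h₂⟩
    rw [mem_loopSet_iff_sameCycle] at h₂
    have hn := hj.le_of_sameCycle (h₂.trans (sameCycle_of_mem_pathSet h₁).symm)
    rw [Fin.val_castAdd] at hn
    omega
  · by_cases h : ∀ p : ℕ, n ≤ (((π ^ p) x) : ℕ)
    · exact Or.inr ⟨hx, orderOf π, orderOf_pos π, by simp [pow_orderOf_eq_one], fun p _ => h p⟩
    · push Not at h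
      obtain ⟨p, hp⟩ := h
      have hc : π.SameCycle x ((π ^ p) x) := ⟨p, by simp⟩
      exact Or.inl (exists_mem_pathSet_of_sameCycle hx hp hc.symm)
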